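/- The friendship graph F₃, consisting of three triangles that pairwise share exactly one common vertex v (so F₃ has 7 vertices, 9 edges, v has degree 6 and all other vertices have degree 2), does not admit a cyclic interval 8-coloring. -/

import Mathlib

open SimpleGraph

/-- The set of colors appearing on edges incident to `v` under the edge coloring `c`. -/
def colorsAt {V : Type*} (G : SimpleGraph V) (c : Sym2 V → ℕ) (v : V) : Set ℕ :=
  c '' (G.incidenceSet v)

/-- A set of natural numbers is an interval of consecutive integers. -/
def IsIntervalSet (S : Set ℕ) : Prop := ∃ a b : ℕ, S = Set.Icc a b

/-- A proper edge coloring of `G` with colors `1, …, t`: every edge gets a color in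
`{1, …, t}` and distinct edges sharing a vertex get distinct colors. -/
def IsProperEdgeColoring {V : Type*} (G : SimpleGraph V) (t : ℕ) (c : Sym2 V → ℕ) : Prop :=
  (∀ e ∈ G.edgeSet, c e ∈ Set.Icc 1 t) ∧
  ∀ e₁ ∈ G.edgeSet, ∀ e₂ ∈ G.edgeSet, e₁ ≠ e₂ → (∃ v, v ∈ e₁ ∧ v ∈ e₂) → c e₁ ≠ c e₂

/-- A cyclic interval `t`-coloring of `G`: a proper edge coloring with colors `1, …, t`
such that at every vertex the set of incident colors, or its complement in `{1, …, t}`,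
is an interval of consecutive integers. -/
def IsCyclicIntervalColoring {V : Type*} (G : SimpleGraph V) (t : ℕ) (c : Sym2 V → ℕ) : Prop :=
  IsProperEdgeColoring G t c ∧
  ∀ v : V, IsIntervalSet (colorsAt G c v) ∨ IsIntervalSet (Set.Icc 1 t \ colorsAt G c v)

/-- The friendship graph `F₃`: three triangles `{0,1,2}`, `{0,3,4}`, `{0,5,6}` pairwise
sharing exactly the common vertex `0`. -/
def friendshipF3 : SimpleGraph (Fin 7) :=
  SimpleGraph.fromEdgeSet
    {s(0, 1), s(0, 2), s(1, 2), s(0, 3), s(0, 4), s(3, 4), s(0, 5), s(0, 6), s(5, 6)}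


/-- Intervals are order-convex. -/
lemma IsIntervalSet.conv {S : Set ℕ} (h : IsIntervalSet S) {p q r : ℕ} (hp : p ∈ S) (hr : r ∈ S)
    (h1 : p ≤ q) (h2 : q ≤ r) : q ∈ S := by
  obtain ⟨a, b, rfl⟩ := h
  exact ⟨hp.1.trans h1, h2.trans hr.2⟩

lemma convex_aux : ∀ T ∈ (Finset.Icc 1 8 : Finset ℕ).powerset, (T.card = 2 ∨ T.card = 6) →
    ((∀ p ∈ T, ∀ r ∈ T, ∀ q ∈ Finset.Icc 1 8, p ≤ q → q ≤ r → q ∈ T) ∨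
    (∀ p ∈ Finset.Icc 1 8 \ T, ∀ r ∈ Finset.Icc 1 8 \ T, ∀ q ∈ Finset.Icc 1 8,
      p ≤ q → q ≤ r → q ∉ T)) → (∑ x ∈ T, x) % 2 = 1 := by
  decide +kernel

lemma odd_sum (T : Finset ℕ) (hT : T ⊆ Finset.Icc 1 8) (hc : T.card = 2 ∨ T.card = 6)
    (h : IsIntervalSet (T : Set ℕ) ∨ IsIntervalSet (Set.Icc 1 8 \ (T : Set ℕ))) :
    (∑ x ∈ T, x) % 2 = 1 := by
  refine convex_aux T (Finset.mem_powerset.2 hT) hc (h.imp ?_ ?_)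
  · intro h p hp r hr q _ h1 h2
    exact h.conv hp hr h1 h2
  · intro h p hp r hr q _ h1 h2
    have hp' : p ∈ (Set.Icc 1 8 \ (T : Set ℕ)) := by simpa using hp
    have hr' : r ∈ (Set.Icc 1 8 \ (T : Set ℕ)) := by simpa using hr
    exact (h.conv hp' hr' h1 h2).2

/-- At each vertex of degree 2 or 6 the sum of the incident colors is odd. -/
lemma vertex_odd (c : Sym2 (Fin 7) → ℕ) (h : IsCyclicIntervalColoring friendshipF3 8 c)
    (v : Fin 7) (E : Finset (Sym2 (Fin 7)))
    (hE : ∀ e, e ∈ E ↔ (e ∈ ({s(0, 1), s(0, 2), s(1, 2), s(0, 3), s(0, 4), s(3, 4), s(0, 5),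
      s(0, 6), s(5, 6)} : Finset (Sym2 (Fin 7))) ∧ ¬ e.IsDiag) ∧ v ∈ e)
    (hc : E.card = 2 ∨ E.card = 6) : (∑ e ∈ E, c e) % 2 = 1 := by
  obtain ⟨⟨h1, h2⟩, h3⟩ := h
  have hI : friendshipF3.incidenceSet v = E := by
    ext e
    rw [Finset.mem_coe, hE]
    simp [incidenceSet, friendshipF3]
  have hE' : ∀ e ∈ E, e ∈ friendshipF3.edgeSet ∧ v ∈ e := by
    intro e he
    have : e ∈ friendshipF3.incidenceSet v := by rw [hI]; exact he
    exact this
  have inj : Set.InjOn c E := by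
    intro a ha b hb hab
    by_contra hne
    exact h2 a (hE' a ha).1 b (hE' b hb).1 hne ⟨v, (hE' a ha).2, (hE' b hb).2⟩ hab
  have h4 := h3 v
  rw [colorsAt, hI, ← Finset.coe_image] at h4
  have := odd_sum (E.image c) ?_ ?_ h4
  · rwa [Finset.sum_image inj] at this
  · intro x hx
    obtain ⟨e, he, rfl⟩ := Finset.mem_image.1 hx
    simpa using h1 e (hE' e he).1
  · rwa [Finset.card_image_of_injOn inj]

/-- the friendship graph `F₃` does not admit a cyclic interval
`8`-coloring. -/
theorem stmt_19 :
    ¬ ∃ c : Sym2 (Fin 7) → ℕ, IsCyclicIntervalColoring friendshipF3 8 c := by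
  rintro ⟨c, h⟩
  have h0 := vertex_odd c h 0 {s(0, 1), s(0, 2), s(0, 3), s(0, 4), s(0, 5), s(0, 6)}
    (by decide +kernel) (by decide +kernel)
  have h1 := vertex_odd c h 1 {s(0, 1), s(1, 2)} (by decide +kernel) (by decide +kernel)
  have h2 := vertex_odd c h 2 {s(0, 2), s(1, 2)} (by decide +kernel) (by decide +kernel)
  have h3 := vertex_odd c h 3 {s(0, 3), s(3, 4)} (by decide +kernel) (by decide +kernel)
  have h4 := vertex_odd c h 4 {s(0, 4), s(3, 4)} (by decide +kernel) (by decide +kernel)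
  have h5 := vertex_odd c h 5 {s(0, 5), s(5, 6)} (by decide +kernel) (by decide +kernel)
  have h6 := vertex_odd c h 6 {s(0, 6), s(5, 6)} (by decide +kernel) (by decide +kernel)
  rw [Finset.sum_pair (by decide)] at h1 h2 h3 h4 h5 h6
  rw [Finset.sum_insert (by decide), Finset.sum_insert (by decide), Finset.sum_insert (by decide),
    Finset.sum_insert (by decide), Finset.sum_pair (by decide)] at h0
  omega
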